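/- For k, m ≥ 2, the monoid POI_{k×m} has a generating set of size 2k, namely D̄ ∪ X̄ where D̄ = {d̄_1,...,d̄_k} are units corresponding to the generators d_i of S_m^k and X̄ = {x̄_0,...,x̄_{k−1}} are the images of the standard generators of POI_k. -/

import Mathlib

noncomputable section

namespace POIPaper

instance pequivMonoid (α : Type*) : Monoid (α ≃. α) where
  one := PEquiv.refl α
  mul f g := f.trans g
  mul_assoc := PEquiv.trans_assoc
  one_mul := PEquiv.refl_trans
  mul_one := PEquiv.trans_refl

/-- `f` is `P`-stable for the ordered partition of `Ω` given by the block-index map `ι`. -/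
def PStable {Ω : Type*} {k : ℕ} (ι : Ω → Fin k) (f : Ω ≃. Ω) : Prop :=
  ∀ x y : Ω, y ∈ f x →
    (∀ z, ι z = ι x → (f z).isSome) ∧
    (∀ z w, w ∈ f z → ι z = ι x → ι w = ι y) ∧
    (∀ w, ι w = ι y → ∃ z, ι z = ι x ∧ w ∈ f z)

/-- `f` is `P`-order preserving for the ordered partition given by `ι`. -/
def POrdPres {Ω : Type*} {k : ℕ} (ι : Ω → Fin k) (f : Ω ≃. Ω) : Prop :=
  ∀ x y x' y' : Ω, x' ∈ f x → y' ∈ f y → ι x ≤ ι y → ι x' ≤ ι y'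

/-- The set `POI(Ω,P)` of all `P`-stable and `P`-order preserving partial permutations. -/
def POISet {Ω : Type*} {k : ℕ} (ι : Ω → Fin k) : Set (Ω ≃. Ω) :=
  {f | PStable ι f ∧ POrdPres ι f}

/-- Block index map of the uniform interval partition of `{1,...,km}` into `k` blocks of size `m`. -/
def blk (k m : ℕ) (a : Fin (k * m)) : Fin k :=
  ⟨(a : ℕ) / m, by
    have ha := a.isLt
    rcases Nat.eq_zero_or_pos m with h | h
    · subst h; simp at ha
    · rw [Nat.div_lt_iff_lt_mul h]; omega⟩

/-- The monoid `POI_{k×m}` (as a subset of the monoid of partial permutations). -/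
def POIkm (k m : ℕ) : Set (Fin (k * m) ≃. Fin (k * m)) := POISet (blk k m)

/-- The cardinality of the image of a partial permutation. -/
def imCard {n : ℕ} (f : Fin n ≃. Fin n) : ℕ := Set.ncard {b | (f.symm b).isSome}

/-- The `J`-preorder of the monoid `POI_{k×m}`: `α ≤_J β` iff `α ∈ M β M`. -/
def leJ (k m : ℕ) (α β : Fin (k * m) ≃. Fin (k * m)) : Prop :=
  ∃ s ∈ POIkm k m, ∃ t ∈ POIkm k m, α = s * β * t

/-- Order preserving partial permutations of a chain. -/
def OrdPres {n : ℕ} (f : Fin n ≃. Fin n) : Prop :=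
  ∀ x y x' y' : Fin n, x' ∈ f x → y' ∈ f y → x ≤ y → x' ≤ y'

/-- The group of units of `POI_{k×m}`: elements with full domain and image. -/
def unitsSet (k m : ℕ) : Set (Fin (k * m) ≃. Fin (k * m)) :=
  {f | f ∈ POIkm k m ∧ (∀ a, (f a).isSome) ∧ (∀ b, (f.symm b).isSome)}

/-- The set `X̄ = {x̄_0, x̄_1, …, x̄_{k−1}}` of images under `ψ` of the standard generators of
`POI_k`, characterized pointwise (blocks are 0-indexed: `x̄_0` shifts every block down by one,
and for `1 ≤ i ≤ k−1`, `x̄_i` is undefined on block `k−i`, maps block `k−i−1` to block `k−i`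
and is the identity on all other blocks, always preserving residues mod `m`). -/
def XbarSet (k m : ℕ) : Set (Fin (k * m) ≃. Fin (k * m)) :=
  {f | ∀ a b : Fin (k * m),
      b ∈ f a ↔ ((b : ℕ) % m = (a : ℕ) % m ∧ (b : ℕ) / m + 1 = (a : ℕ) / m)} ∪
  {f | ∃ i : ℕ, 1 ≤ i ∧ i ≤ k - 1 ∧ ∀ a b : Fin (k * m),
      b ∈ f a ↔ ((b : ℕ) % m = (a : ℕ) % m ∧ (a : ℕ) / m ≠ k - i ∧
        (((a : ℕ) / m = k - i - 1 ∧ (b : ℕ) / m = k - i) ∨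
         ((a : ℕ) / m ≠ k - i - 1 ∧ (b : ℕ) / m = (a : ℕ) / m)))}

lemma gen_pair (m : ℕ) (hm : 2 ≤ m) : ∃ x y : Equiv.Perm (Fin m), ∃ t : ℕ,
    x ≠ 1 ∧ x * x = 1 ∧ y ^ (2 * t + 1) = 1 ∧ Subgroup.closure {x, y} = ⊤ := by
  obtain ⟨n, rfl⟩ : ∃ n, m = n + 2 := ⟨m - 2, by omega⟩
  have hcl : Subgroup.closure ({finRotate (n+2), Equiv.swap (Fin.last (n+1)) 0} :
      Set (Equiv.Perm (Fin (n+2)))) = ⊤ := by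
    have := Equiv.Perm.closure_cycle_adjacent_swap (isCycle_finRotate (n := n))
      (support_finRotate) (Fin.last (n+1))
    rwa [finRotate_last] at this
  have hne : (Fin.last (n+1)) ≠ 0 := by simp [Fin.ext_iff]
  have hx1 : Equiv.swap (Fin.last (n+1)) 0 ≠ 1 := by
    intro h
    exact hne (Equiv.swap_eq_one_iff.mp h)
  rcases Nat.even_or_odd' n with ⟨t, ht | ht⟩
  · refine ⟨Equiv.swap (Fin.last (n+1)) 0, Fin.cycleRange (Fin.castSucc (Fin.last n)), t, hx1,
      Equiv.swap_mul_self _ _, ?_, ?_⟩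
    · by_cases h0 : n = 0
      · subst h0
        obtain rfl : t = 0 := by omega
        simp
      · have h := Fin.cycleType_cycleRange (n := n + 2) (i := Fin.castSucc (Fin.last n))
          (by simp [Fin.ext_iff, h0])
        have h2 := Equiv.Perm.lcm_cycleType (Fin.cycleRange (Fin.castSucc (Fin.last n)))
        rw [h] at h2
        simp at h2
        rw [← orderOf_dvd_iff_pow_eq_one, ← h2, ht]
    · have key : finRotate (n+2) = Equiv.swap (Fin.last (n+1)) 0 *
          Fin.cycleRange (Fin.castSucc (Fin.last n)) := by
        ext j
        rw [Equiv.Perm.mul_apply]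
        rcases lt_trichotomy j (Fin.castSucc (Fin.last n)) with hj | hj | hj
        · rw [Fin.cycleRange_of_lt hj, Equiv.swap_apply_of_ne_of_ne, finRotate_apply]
          · simp only [Fin.lt_def, Fin.val_castSucc, Fin.val_last] at hj
            simp only [ne_eq, Fin.ext_iff, Fin.val_last]
            rw [Fin.val_add_one_of_lt (by simp [Fin.lt_def]; omega)]
            omega
          · simp only [Fin.lt_def, Fin.val_castSucc, Fin.val_last] at hj
            simp only [ne_eq, Fin.ext_iff]
            rw [Fin.val_add_one_of_lt (by simp [Fin.lt_def]; omega)]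
            simp
        · rw [Fin.cycleRange_of_eq hj, Equiv.swap_apply_right, hj, finRotate_apply]
          rw [Fin.val_add_one_of_lt (by simp [Fin.lt_def])]
          simp
        · have : j = Fin.last (n+1) := by
            simp only [Fin.lt_def, Fin.val_castSucc, Fin.val_last] at hj
            simp only [Fin.ext_iff, Fin.val_last]
            omega
          rw [Fin.cycleRange_of_gt hj, this, Equiv.swap_apply_left, finRotate_last]
      rw [eq_top_iff, ← hcl, Subgroup.closure_le]
      rintro z (rfl | rfl)
      · rw [key]
        exact mul_mem (Subgroup.subset_closure (by simp)) (Subgroup.subset_closure (by simp))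
      · exact Subgroup.subset_closure (by simp)
  · refine ⟨Equiv.swap (Fin.last (n+1)) 0, finRotate (n+2), t + 1, hx1,
      Equiv.swap_mul_self _ _, ?_, ?_⟩
    · have h2 := Equiv.Perm.lcm_cycleType (finRotate (n+2))
      rw [cycleType_finRotate] at h2
      simp at h2
      rw [← orderOf_dvd_iff_pow_eq_one, ← h2, ht]
      exact dvd_of_eq (by ring)
    · rw [Set.pair_comm]; exact hcl

def dgen {G : Type*} [Group G] (n : ℕ) (x y : G) (i : Fin (n + 1)) : Fin (n + 1) → G :=
  Pi.mulSingle i x * Pi.mulSingle (i + 1) y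

lemma fin_ne_succ {n : ℕ} (hn : 1 ≤ n) (i : Fin (n+1)) : i ≠ i + 1 := by
  obtain ⟨n, rfl⟩ : ∃ t, n = t + 1 := ⟨n - 1, by omega⟩
  intro h
  have : (1 : Fin (n+1+1)) = 0 := by
    have := h.symm
    simp at this
  simp at this

lemma dgen_closure {G : Type*} [Group G] [Finite G] (n : ℕ) (hn : 1 ≤ n) (x y : G) (t : ℕ)
    (hx : x * x = 1) (hy : y ^ (2 * t + 1) = 1) (hc : Subgroup.closure {x, y} = ⊤) :
    Submonoid.closure (Set.range (dgen n x y)) = ⊤ := by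
  have hx2 : x ^ 2 = 1 := by rw [pow_two, hx]
  have hcomm : ∀ i : Fin (n+1), Commute (Pi.mulSingle i x : Fin (n+1) → G)
      (Pi.mulSingle (i+1) y) := fun i => Pi.mulSingle_commute (f := fun _ : Fin (n+1) => G) (fin_ne_succ hn i) x y
  rw [← Subgroup.closure_toSubmonoid_of_finite, ← Subgroup.top_toSubmonoid]
  congr 1
  have hd : ∀ i, dgen n x y i ∈ Subgroup.closure (Set.range (dgen n x y)) :=
    fun i => Subgroup.subset_closure ⟨i, rfl⟩
  have h1 : ∀ i, Pi.mulSingle i x ∈ Subgroup.closure (Set.range (dgen n x y)) := by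
    intro i
    have h := pow_mem (hd i) (2 * t + 1)
    rw [dgen, (hcomm i).mul_pow, ← Pi.mulSingle_pow, ← Pi.mulSingle_pow, hy, pow_succ, pow_mul,
      hx2] at h
    simpa using h
  have h2 : ∀ i, Pi.mulSingle (i + 1) y ∈ Subgroup.closure (Set.range (dgen n x y)) := by
    intro i
    have h := pow_mem (hd i) (2 * (t + 1))
    rw [dgen, (hcomm i).mul_pow, ← Pi.mulSingle_pow, ← Pi.mulSingle_pow, pow_mul,
      hx2, show 2 * (t + 1) = (2 * t + 1) + 1 by ring, pow_succ y, hy] at h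
    simpa using h
  have h3 : ∀ i g, Pi.mulSingle i g ∈ Subgroup.closure (Set.range (dgen n x y)) := by
    intro i g
    have : Subgroup.closure {x, y} ≤ (Subgroup.closure (Set.range (dgen n x y))).comap
        (MonoidHom.mulSingle (fun _ : Fin (n+1) => G) i) := by
      rw [Subgroup.closure_le]
      rintro z (rfl | rfl)
      · exact h1 i
      · have := h2 (i - 1)
        rw [sub_add_cancel] at this
        exact this
    rw [hc] at this
    exact this (Subgroup.mem_top g)
  rw [eq_top_iff]
  intro s _
  exact Subgroup.pi_mem_of_mulSingle_mem s fun i => h3 i _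

lemma dgen_inj {G : Type*} [Group G] (n : ℕ) (hn : 1 ≤ n) (x y : G) (t : ℕ) (hx1 : x ≠ 1)
    (hx : x * x = 1) (hy : y ^ (2 * t + 1) = 1) : Function.Injective (dgen n x y) := by
  intro i j h
  by_contra hij
  have h := congrFun h i
  have hxy : x ≠ y := by
    rintro rfl
    rw [pow_succ, pow_mul, pow_two, hx] at hy
    simp at hy
    exact hx1 hy
  simp only [dgen, Pi.mul_apply, Pi.mulSingle_eq_same, Pi.mulSingle_eq_of_ne (fin_ne_succ hn i),
    Pi.mulSingle_eq_of_ne hij, mul_one, one_mul] at h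
  by_cases h' : i = j + 1
  · rw [h', Pi.mulSingle_eq_same] at h
    exact hxy h
  · rw [Pi.mulSingle_eq_of_ne h'] at h
    exact hx1 h

lemma mem_mul {α : Type*} (f g : α ≃. α) (a c : α) :
    c ∈ (f * g) a ↔ ∃ b, b ∈ f a ∧ c ∈ g b := PEquiv.mem_trans f g a c

lemma mem_one {α : Type*} (a c : α) : c ∈ (1 : α ≃. α) a ↔ a = c := by
  change c ∈ (PEquiv.refl α) a ↔ _
  simp

lemma pext {α β : Type*} {f g : α ≃. β} (h : ∀ a b, b ∈ f a ↔ b ∈ g a) : f = g := by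
  apply PEquiv.ext
  intro a
  exact Option.ext (fun b => h a b)

lemma mem_uniq {α β : Type*} {f : α ≃. β} {a : α} {b c : β} (h : b ∈ f a) (h' : c ∈ f a) :
    b = c := Option.mem_unique h h'

/-- order embedding skipping `a`, as a partial bijection -/
def io {n : ℕ} (a : Fin (n+1)) : Fin n ≃. Fin (n+1) where
  toFun i := some (a.succAbove i)
  invFun j := by
    classical exact if h : ∃ i, a.succAbove i = j then some h.choose else none
  inv i j := by
    classical
    constructor
    · intro h
      split_ifs at h with h'
      · have := h'.choose_spec
        rw [Option.some.injEq] at h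
        rw [h] at this
        rw [this]
    · intro h
      rw [Option.some.injEq] at h
      have h' : ∃ i, a.succAbove i = j := ⟨i, h⟩
      rw [dif_pos h', Option.some.injEq]
      exact Fin.succAbove_right_injective (h'.choose_spec.trans h.symm)

lemma mem_io {n : ℕ} (a : Fin (n+1)) (i : Fin n) (j : Fin (n+1)) :
    j ∈ io a i ↔ a.succAbove i = j := by
  change j ∈ some _ ↔ _
  simp

lemma mem_io_symm {n : ℕ} (a : Fin (n+1)) (i : Fin n) (j : Fin (n+1)) :
    i ∈ (io a).symm j ↔ a.succAbove i = j := by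
  rw [PEquiv.mem_iff_mem, mem_io]

def AA {n : ℕ} (a b : Fin (n+1)) : Fin (n+1) ≃. Fin (n+1) := (io a).symm.trans (io b)

lemma mem_AA {n : ℕ} (a b x y : Fin (n+1)) :
    y ∈ AA a b x ↔ ∃ i, a.succAbove i = x ∧ b.succAbove i = y := by
  simp only [AA, PEquiv.mem_trans, mem_io, mem_io_symm]

lemma AA_mul {n : ℕ} (a b c : Fin (n+1)) : AA a b * AA b c = AA a c := by
  apply pext
  intro x y
  simp only [mem_mul, mem_AA]
  constructor
  · rintro ⟨z, ⟨i, h1, h2⟩, j, h3, h4⟩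
    have := Fin.succAbove_right_injective (h2.trans h3.symm)
    subst this
    exact ⟨i, h1, h4⟩
  · rintro ⟨i, h1, h2⟩
    exact ⟨_, ⟨i, h1, rfl⟩, i, rfl, h2⟩

def GG : (n : ℕ) → Set (Fin n ≃. Fin n)
  | 0 => ∅
  | _ + 1 => {g | ∃ a b, g = AA a b}

def LL {n : ℕ} (f : Fin n ≃. Fin n) : Fin (n+1) ≃. Fin (n+1) :=
  (io (Fin.last n)).symm.trans (f.trans (io (Fin.last n)))

lemma mem_LL {n : ℕ} (f : Fin n ≃. Fin n) (x y : Fin (n+1)) :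
    y ∈ LL f x ↔ ∃ i j, j ∈ f i ∧ i.castSucc = x ∧ j.castSucc = y := by
  simp only [LL, PEquiv.mem_trans, mem_io, mem_io_symm, Fin.succAbove_last]
  grind

lemma LL_mul {n : ℕ} (f g : Fin n ≃. Fin n) : LL (f * g) = LL f * LL g := by
  apply pext
  intro x y
  simp only [mem_mul, mem_LL]
  constructor
  · rintro ⟨i, j, ⟨l, h1, h2⟩, h3, h4⟩
    exact ⟨_, ⟨i, l, h1, h3, rfl⟩, l, j, h2, rfl, h4⟩
  · rintro ⟨z, ⟨i, j, h1, h2, h3⟩, i', j', h4, h5, h6⟩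
    have := Fin.castSucc_injective _ (h3.trans h5.symm)
    subst this
    exact ⟨i, j', ⟨j, h1, h4⟩, h2, h6⟩

lemma LL_one {n : ℕ} : LL (1 : Fin n ≃. Fin n) = AA (Fin.last n) (Fin.last n) := by
  apply pext
  intro x y
  simp only [mem_one, mem_LL, mem_AA, Fin.succAbove_last]
  grind

lemma LL_AA {n : ℕ} (a b : Fin (n+1)) :
    LL (AA a b) = AA a.castSucc b.castSucc * AA (Fin.last _) (Fin.last _) := by
  apply pext
  intro x y
  simp only [mem_mul, mem_LL, mem_AA, Fin.succAbove_last]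
  constructor
  · rintro ⟨i, j, ⟨l, h1, h2⟩, h3, h4⟩
    refine ⟨y, ⟨l.castSucc, ?_, ?_⟩, j, h4, h4⟩
    · rw [Fin.castSucc_succAbove_castSucc, h1, h3]
    · rw [Fin.castSucc_succAbove_castSucc, h2, h4]
  · rintro ⟨z, ⟨i, h1, h2⟩, j, h3, h4⟩
    induction i using Fin.lastCases with
    | last =>
      rw [Fin.succAbove_of_le_castSucc _ _ (by simp [Fin.le_def]; omega)] at h2
      rw [← h3] at h2
      simp [Fin.ext_iff] at h2
      omega
    | cast l =>
      rw [Fin.castSucc_succAbove_castSucc] at h1 h2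
      have := Fin.castSucc_injective _ (h2.trans h3.symm)
      exact ⟨_, j, ⟨l, rfl, this⟩, h1, h4⟩

lemma LL_closure {n : ℕ} {f : Fin n ≃. Fin n} (hf : f ∈ Submonoid.closure (GG n)) :
    LL f ∈ Submonoid.closure (GG (n+1)) := by
  induction hf using Submonoid.closure_induction with
  | mem x hx =>
    cases n with
    | zero => exact hx.elim
    | succ n =>
      obtain ⟨a, b, rfl⟩ := hx
      rw [LL_AA]
      exact mul_mem (Submonoid.subset_closure ⟨_, _, rfl⟩) (Submonoid.subset_closure ⟨_, _, rfl⟩)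
  | one => rw [LL_one]; exact Submonoid.subset_closure ⟨_, _, rfl⟩
  | mul x y _ _ hx hy => rw [LL_mul]; exact mul_mem hx hy

lemma io_OP {n : ℕ} (a b : Fin (n+1)) (f : Fin (n+1) ≃. Fin (n+1)) (hf : OrdPres f) :
    OrdPres ((io a).trans (f.trans (io b).symm)) := by
  intro x y x' y' hx hy hxy
  simp only [PEquiv.mem_trans, mem_io, mem_io_symm] at hx hy
  obtain ⟨u, rfl, v, h1, h2⟩ := hx
  obtain ⟨u', rfl, v', h1', h2'⟩ := hy
  have := hf _ _ _ _ h1 h1' (by simpa using hxy)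
  rw [← h2, ← h2'] at this
  simpa using this

lemma decomp {n : ℕ} (a b : Fin (n+1)) (f : Fin (n+1) ≃. Fin (n+1)) (ha : f a = none)
    (hb : f.symm b = none) :
    f = AA a (Fin.last n) * LL ((io a).trans (f.trans (io b).symm)) * AA (Fin.last n) b := by
  apply pext
  intro x y
  simp only [mem_mul, mem_LL, mem_AA, Fin.succAbove_last, PEquiv.mem_trans, mem_io, mem_io_symm]
  constructor
  · intro h
    have hx : x ≠ a := by rintro rfl; rw [ha] at h; cases h
    have hy : y ≠ b := by
      rintro rfl; rw [← PEquiv.mem_iff_mem, hb] at h; cases h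
    obtain ⟨i, rfl⟩ := Fin.exists_succAbove_eq hx
    obtain ⟨j, rfl⟩ := Fin.exists_succAbove_eq hy
    exact ⟨j.castSucc, ⟨i.castSucc, ⟨i, rfl, rfl⟩, i, j, ⟨_, rfl, _, h, rfl⟩, rfl, rfl⟩, j, rfl, rfl⟩
  · rintro ⟨u, ⟨v, ⟨i, rfl, rfl⟩, i', j, ⟨w, rfl, w', h, rfl⟩, h2, rfl⟩, j', h3, rfl⟩
    have := Fin.castSucc_injective _ h2
    have := Fin.castSucc_injective _ h3
    subst_vars
    exact h

lemma total_id {n : ℕ} (f : Fin n ≃. Fin n) (hf : OrdPres f) (ht : ∀ a, f a ≠ none) : f = 1 := by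
  have h : ∀ a, ∃ b, b ∈ f a := by
    intro a
    obtain ⟨b, hb⟩ := Option.ne_none_iff_exists'.mp (ht a)
    exact ⟨b, hb⟩
  choose g hg using h
  have hm : StrictMono g := by
    have h1 : Monotone g := fun x y hxy => hf _ _ _ _ (hg x) (hg y) hxy
    apply h1.strictMono_of_injective
    intro x y hxy
    exact f.inj (hg x) (hxy ▸ hg y)
  have hid : g = id := by
    have hb : Function.Surjective g := Finite.surjective_of_injective hm.injective
    exact (hm.range_inj strictMono_id).mp (by rw [hb.range_eq]; simp)
  apply pext
  intro a b
  rw [mem_one]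
  have := hg a
  rw [hid] at this
  constructor
  · intro h; exact mem_uniq this h
  · rintro rfl; exact this

lemma OP_closure : ∀ (n : ℕ) (f : Fin n ≃. Fin n), OrdPres f → f ∈ Submonoid.closure (GG n) := by
  intro n
  induction n with
  | zero =>
    intro f hf
    rw [total_id f hf (fun a => a.elim0)]
    exact one_mem _
  | succ n ih =>
    intro f hf
    by_cases h : ∃ a, f a = none
    · obtain ⟨a, ha⟩ := h
      have hb : ∃ b, f.symm b = none := by
        by_contra hcon
        have h : ∀ a, ∃ b, b ∈ f.symm a := by
          intro a
          obtain ⟨b, hb⟩ := Option.ne_none_iff_exists'.mp (fun h => hcon ⟨a, h⟩)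
          exact ⟨b, hb⟩
        choose g hg using h
        have hi : Function.Injective g := fun x y hxy => f.symm.inj (hg x) (hxy ▸ hg y)
        obtain ⟨c, hc⟩ := Finite.surjective_of_injective hi a
        have := hg c
        rw [hc, PEquiv.mem_iff_mem, ha] at this
        cases this
      obtain ⟨b, hb⟩ := hb
      rw [decomp a b f ha hb]
      exact mul_mem (mul_mem (Submonoid.subset_closure ⟨_, _, rfl⟩)
        (LL_closure (ih _ (io_OP a b f hf)))) (Submonoid.subset_closure ⟨_, _, rfl⟩)
    · rw [total_id f hf (fun a ha => h ⟨a, ha⟩)]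
      exact one_mem _

def xg (n : ℕ) (i : Fin (n+1)) : Fin (n+1) ≃. Fin (n+1) := AA i (i - 1)

lemma xg_zero (n : ℕ) : xg n 0 = AA 0 (Fin.last n) := by
  rw [xg]; congr 1
  rw [sub_eq_iff_eq_add]; simp

lemma xg_succ (n : ℕ) (i : Fin n) : xg n i.succ = AA i.succ i.castSucc := by
  rw [xg]; congr 1
  rw [sub_eq_iff_eq_add]; simp

lemma AA_closure (n : ℕ) (a b : Fin (n+1)) :
    AA a b ∈ Submonoid.closure (Set.range (xg n)) := by
  have h0 : AA 0 (Fin.last n) ∈ Submonoid.closure (Set.range (xg n)) :=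
    Submonoid.subset_closure ⟨0, xg_zero n⟩
  have hs : ∀ i : Fin n, AA i.succ i.castSucc ∈ Submonoid.closure (Set.range (xg n)) :=
    fun i => Submonoid.subset_closure ⟨i.succ, xg_succ n i⟩
  have h1 : ∀ c : Fin (n+1), AA (Fin.last n) c ∈ Submonoid.closure (Set.range (xg n)) ∨
      c = Fin.last n := by
    intro c
    induction c using Fin.reverseInduction with
    | last => right; rfl
    | cast i ih =>
      left
      rcases ih with ih | ih
      · rw [← AA_mul _ i.succ]; exact mul_mem ih (hs i)
      · rw [← ih]; exact hs i
  have h2 : ∀ c : Fin (n+1), AA c (Fin.last n) ∈ Submonoid.closure (Set.range (xg n)) := by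
    intro c
    induction c using Fin.induction with
    | zero => exact h0
    | succ i ih => rw [← AA_mul _ i.castSucc]; exact mul_mem (hs i) ih
  rcases h1 b with h | rfl
  · rw [← AA_mul _ (Fin.last n)]; exact mul_mem (h2 a) h
  · exact h2 a

lemma OP_closure_xg (n : ℕ) (f : Fin (n+1) ≃. Fin (n+1)) (hf : OrdPres f) :
    f ∈ Submonoid.closure (Set.range (xg n)) := by
  have : Submonoid.closure (GG (n+1)) ≤ Submonoid.closure (Set.range (xg n)) := by
    rw [Submonoid.closure_le]
    rintro _ ⟨a, b, rfl⟩
    exact AA_closure n a b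
  exact this (OP_closure _ f hf)

lemma AA_none {n : ℕ} (a b x : Fin (n+1)) : AA a b x = none ↔ x = a := by
  constructor
  · intro h
    by_contra hx
    obtain ⟨i, hi⟩ := Fin.exists_succAbove_eq hx
    have : b.succAbove i ∈ AA a b x := (mem_AA _ _ _ _).mpr ⟨i, hi, rfl⟩
    rw [h] at this
    cases this
  · rintro rfl
    rw [Option.eq_none_iff_forall_not_mem]
    intro y hy
    obtain ⟨i, hi, _⟩ := (mem_AA _ _ _ _).mp hy
    exact Fin.succAbove_ne _ _ hi

lemma AA_OP {n : ℕ} (a b : Fin (n+1)) : OrdPres (AA a b) := by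
  intro x y x' y' hx hy hxy
  obtain ⟨i, rfl, rfl⟩ := (mem_AA _ _ _ _).mp hx
  obtain ⟨j, rfl, rfl⟩ := (mem_AA _ _ _ _).mp hy
  simpa using hxy

lemma xg_inj (n : ℕ) : Function.Injective (xg n) := by
  intro i j h
  have := (AA_none i (i-1) i).mpr rfl
  change xg n i i = none at this
  rw [h] at this
  exact (AA_none j (j-1) i).mp this

lemma mem_AA_zero {n : ℕ} (x y : Fin (n+1)) :
    y ∈ AA 0 (Fin.last n) x ↔ (y : ℕ) + 1 = x := by
  rw [mem_AA]
  simp only [Fin.succAbove_zero, Fin.succAbove_last]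
  constructor
  · rintro ⟨i, rfl, rfl⟩; simp
  · intro h
    have hx := x.isLt
    exact ⟨⟨y, by omega⟩, by ext; simpa using h, by ext; simp⟩

lemma mem_AA_succ {n : ℕ} (q : Fin n) (x y : Fin (n+1)) :
    y ∈ AA q.succ q.castSucc x ↔ ((x : ℕ) ≠ q + 1 ∧
        (((x : ℕ) = q ∧ (y : ℕ) = q + 1) ∨ ((x : ℕ) ≠ q ∧ (y : ℕ) = x))) := by
  rw [mem_AA]
  simp only [Fin.succAbove, Fin.lt_def, Fin.val_castSucc, Fin.val_succ]
  have hx := x.isLt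
  have hy := y.isLt
  have hq := q.isLt
  constructor
  · rintro ⟨i, h1, h2⟩
    split_ifs at h1 h2 <;> simp only [Fin.ext_iff, Fin.val_castSucc, Fin.val_succ] at h1 h2 <;> omega
  · rintro ⟨h1, h2⟩
    by_cases h : (x : ℕ) ≤ q
    · refine ⟨⟨x, by omega⟩, ?_, ?_⟩ <;> split_ifs <;>
        simp only [Fin.ext_iff, Fin.val_castSucc, Fin.val_succ] at * <;> omega
    · refine ⟨⟨x - 1, by omega⟩, ?_, ?_⟩ <;> split_ifs <;>
        simp only [Fin.ext_iff, Fin.val_castSucc, Fin.val_succ] at * <;> omega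

def mk {k m : ℕ} (i : Fin k) (r : Fin m) : Fin (k * m) := finProdFinEquiv (i, r)

lemma blk_mk {k m : ℕ} (i : Fin k) (r : Fin m) : blk k m (mk i r) = i :=
  congrArg Prod.fst (finProdFinEquiv.symm_apply_apply (i, r))

lemma mod_mk {k m : ℕ} (i : Fin k) (r : Fin m) : (mk i r).modNat = r :=
  congrArg Prod.snd (finProdFinEquiv.symm_apply_apply (i, r))

lemma mk_eta {k m : ℕ} (a : Fin (k * m)) : mk (blk k m a) a.modNat = a :=
  finProdFinEquiv.apply_symm_apply a

lemma bext {k m : ℕ} {a b : Fin (k * m)} (h : blk k m a = blk k m b)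
    (h' : a.modNat = b.modNat) : a = b := by
  rw [← mk_eta a, ← mk_eta b, h, h']

def EE {k m : ℕ} (f : Fin k ≃. Fin k) (s : Fin k → Equiv.Perm (Fin m)) :
    Fin (k * m) ≃. Fin (k * m) where
  toFun a := (f (blk k m a)).map (fun j => mk j (s (blk k m a) a.modNat))
  invFun b := (f.symm (blk k m b)).map (fun i => mk i ((s i)⁻¹ b.modNat))
  inv a b := by
    simp only [Option.map_eq_some_iff]
    constructor
    · rintro ⟨i, h, rfl⟩
      refine ⟨blk k m b, ?_, ?_⟩
      · rw [blk_mk]; exact (PEquiv.eq_some_iff f).mp h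
      · rw [blk_mk, mod_mk]; simp [mk_eta]
    · rintro ⟨i, h, rfl⟩
      refine ⟨blk k m a, ?_, ?_⟩
      · rw [blk_mk]; exact (PEquiv.eq_some_iff f).mpr h
      · rw [mod_mk]; simp [mk_eta]

lemma mem_EE {k m : ℕ} (f : Fin k ≃. Fin k) (s : Fin k → Equiv.Perm (Fin m))
    (a b : Fin (k * m)) :
    b ∈ EE f s a ↔ blk k m b ∈ f (blk k m a) ∧ b.modNat = s (blk k m a) a.modNat := by
  change b ∈ (f (blk k m a)).map (fun j => mk j (s (blk k m a) a.modNat)) ↔ _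
  rw [Option.mem_map]
  constructor
  · rintro ⟨j, h, rfl⟩
    rw [blk_mk, mod_mk]; exact ⟨h, rfl⟩
  · rintro ⟨h, h'⟩
    exact ⟨_, h, by rw [← h', mk_eta]⟩

/-- purely blockwise elements -/
def EH (k m : ℕ) : (Fin k ≃. Fin k) →* (Fin (k * m) ≃. Fin (k * m)) where
  toFun f := EE f 1
  map_one' := by
    apply pext
    intro a b
    simp only [mem_EE, mem_one, Pi.one_apply, Equiv.Perm.one_apply]
    constructor
    · rintro ⟨h, h'⟩; exact bext h h'.symm
    · rintro rfl; exact ⟨rfl, rfl⟩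
  map_mul' f g := by
    apply pext
    intro a b
    simp only [mem_EE, mem_mul, Pi.one_apply, Equiv.Perm.one_apply]
    constructor
    · rintro ⟨⟨j, h1, h2⟩, h'⟩
      exact ⟨mk j a.modNat, by simp only [blk_mk, mod_mk]; exact ⟨h1, trivial⟩,
        by simp only [blk_mk, mod_mk]; exact ⟨h2, h'⟩⟩
    · rintro ⟨c, ⟨h1, h2⟩, h3, h4⟩; exact ⟨⟨_, h1, h3⟩, h4.trans h2⟩

/-- units -/
def UH (k m : ℕ) : (Fin k → Equiv.Perm (Fin m)) →* (Fin (k * m) ≃. Fin (k * m)) where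
  toFun s := EE 1 s⁻¹
  map_one' := by
    rw [inv_one]; exact (EH k m).map_one
  map_mul' s t := by
    apply pext
    intro a b
    simp only [mem_EE, mem_mul, mem_one, mul_inv_rev, Pi.mul_apply, Pi.inv_apply,
      Equiv.Perm.mul_apply]
    constructor
    · rintro ⟨h1, h2⟩
      exact ⟨mk (blk k m a) ((s (blk k m a))⁻¹ a.modNat),
        by simp only [blk_mk, mod_mk]; exact ⟨trivial, trivial⟩,
        by simp only [blk_mk, mod_mk]; exact ⟨h1, h2⟩⟩
    · rintro ⟨c, ⟨h1, h2⟩, h3, h4⟩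
      exact ⟨h1.trans h3, by rw [h4, h2, h1]⟩

lemma EE_factor {k m : ℕ} (f : Fin k ≃. Fin k) (s : Fin k → Equiv.Perm (Fin m)) :
    EE f s = UH k m s⁻¹ * EH k m f := by
  apply pext
  intro a b
  rw [mem_mul]
  change _ ↔ ∃ c, c ∈ EE 1 (s⁻¹)⁻¹ a ∧ b ∈ EE f 1 c
  simp only [mem_EE, mem_one, inv_inv, Pi.one_apply, Equiv.Perm.one_apply]
  constructor
  · rintro ⟨h1, h2⟩
    exact ⟨mk (blk k m a) (s (blk k m a) a.modNat),
        by simp only [blk_mk, mod_mk]; exact ⟨trivial, trivial⟩,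
        by simp only [blk_mk, mod_mk]; exact ⟨h1, h2⟩⟩
  · rintro ⟨c, ⟨h1, h2⟩, h3, h4⟩
    exact ⟨by rw [h1]; exact h3, h4.trans h2⟩

lemma EE_mem {k m : ℕ} (f : Fin k ≃. Fin k) (s : Fin k → Equiv.Perm (Fin m))
    (hf : OrdPres f) : EE f s ∈ POIkm k m := by
  constructor
  · intro x y h
    rw [mem_EE] at h
    refine ⟨?_, ?_, ?_⟩
    · intro z hz
      rw [Option.isSome_iff_exists]
      refine ⟨mk (blk k m y) (s (blk k m z) z.modNat), ?_⟩
      rw [← Option.mem_def, mem_EE, blk_mk, mod_mk, hz]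
      exact ⟨h.1, rfl⟩
    · intro z w hw hz
      rw [mem_EE, hz] at hw
      exact mem_uniq hw.1 h.1
    · intro w hw
      refine ⟨mk (blk k m x) ((s (blk k m x))⁻¹ w.modNat), blk_mk _ _, ?_⟩
      rw [mem_EE, blk_mk, mod_mk, hw]
      exact ⟨h.1, by simp⟩
  · intro x y x' y' hx hy hxy
    rw [mem_EE] at hx hy
    exact hf _ _ _ _ hx.1 hy.1 hxy

lemma one_OP (n : ℕ) : OrdPres (1 : Fin n ≃. Fin n) := by
  intro x y x' y' hx hy hxy
  rw [mem_one] at hx hy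
  rwa [← hx, ← hy]

lemma UH_mem {k m : ℕ} (s : Fin k → Equiv.Perm (Fin m)) : UH k m s ∈ unitsSet k m := by
  refine ⟨EE_mem _ _ (one_OP k), ?_, ?_⟩
  · intro a
    rw [Option.isSome_iff_exists]
    refine ⟨mk (blk k m a) (s⁻¹ (blk k m a) a.modNat), ?_⟩
    rw [← Option.mem_def]
    change _ ∈ EE 1 s⁻¹ a
    rw [mem_EE, blk_mk, mod_mk, mem_one]
    exact ⟨rfl, rfl⟩
  · intro b
    rw [Option.isSome_iff_exists]
    refine ⟨mk (blk k m b) (s (blk k m b) b.modNat), ?_⟩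
    rw [← Option.mem_def, PEquiv.mem_iff_mem]
    change _ ∈ EE 1 s⁻¹ _
    rw [mem_EE, blk_mk, mod_mk, mem_one]
    exact ⟨rfl, by simp⟩

lemma UH_inj (k m : ℕ) : Function.Injective (UH k m) := by
  intro s t h
  have h' : s⁻¹ = t⁻¹ := by
    funext i
    ext r
    have h1 : mk i (s⁻¹ i r) ∈ UH k m s (mk i r) := by
      change _ ∈ EE 1 s⁻¹ _
      rw [mem_EE, blk_mk, mod_mk, mem_one, blk_mk, mod_mk]
      exact ⟨rfl, rfl⟩
    rw [h] at h1
    change _ ∈ EE 1 t⁻¹ _ at h1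
    rw [mem_EE, blk_mk, mod_mk, blk_mk, mod_mk] at h1
    rw [h1.2]
  exact inv_injective h'

lemma EH_inj (k m : ℕ) (hm : 0 < m) : Function.Injective (EH k m) := by
  intro f g h
  apply pext
  intro i j
  have key : ∀ u : Fin k ≃. Fin k, j ∈ u i ↔ mk j (⟨0, hm⟩ : Fin m) ∈ EH k m u (mk i ⟨0, hm⟩) := by
    intro u
    change _ ↔ _ ∈ EE u 1 _
    rw [mem_EE, blk_mk, mod_mk, blk_mk, mod_mk]
    simp
  rw [key, key, h]

lemma POI_one (k m : ℕ) : 1 ∈ POIkm k m := by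
  rw [← (EH k m).map_one]
  exact EE_mem _ _ (one_OP k)

lemma POI_mul {k m : ℕ} {f g : Fin (k * m) ≃. Fin (k * m)} (hf : f ∈ POIkm k m)
    (hg : g ∈ POIkm k m) : f * g ∈ POIkm k m := by
  obtain ⟨hf1, hf2⟩ := hf
  obtain ⟨hg1, hg2⟩ := hg
  constructor
  · intro x y h
    obtain ⟨u, hu, hy⟩ := (mem_mul _ _ _ _).mp h
    obtain ⟨a1, a2, a3⟩ := hf1 x u hu
    obtain ⟨b1, b2, b3⟩ := hg1 u y hy
    refine ⟨?_, ?_, ?_⟩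
    · intro z hz
      obtain ⟨v, hv⟩ := Option.isSome_iff_exists.mp (a1 z hz)
      obtain ⟨w, hw⟩ := Option.isSome_iff_exists.mp (b1 v (a2 z v hv hz))
      exact Option.isSome_iff_exists.mpr ⟨w, (mem_mul _ _ _ _).mpr ⟨v, hv, hw⟩⟩
    · intro z w hw hz
      obtain ⟨v, hv, hvw⟩ := (mem_mul _ _ _ _).mp hw
      exact b2 v w hvw (a2 z v hv hz)
    · intro w hw
      obtain ⟨v, hv, hvw⟩ := b3 w hw
      obtain ⟨z, hz, hzv⟩ := a3 v hv
      exact ⟨z, hz, (mem_mul _ _ _ _).mpr ⟨v, hzv, hvw⟩⟩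
  · intro x y x' y' hx hy hxy
    obtain ⟨u, hu, hx'⟩ := (mem_mul _ _ _ _).mp hx
    obtain ⟨v, hv, hy'⟩ := (mem_mul _ _ _ _).mp hy
    exact hg2 _ _ _ _ hx' hy' (hf2 _ _ _ _ hu hv hxy)

lemma POI_decomp {k m : ℕ} (hm : 0 < m) (α : Fin (k * m) ≃. Fin (k * m)) (hα : α ∈ POIkm k m) :
    ∃ f s, OrdPres f ∧ α = EE (m := m) f s := by
  classical
  obtain ⟨h1, h2⟩ := hα
  let R : Fin k → Fin k → Prop := fun i j => ∃ x y, blk k m x = i ∧ blk k m y = j ∧ y ∈ α x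
  have R1 : ∀ i j j', R i j → R i j' → j = j' := by
    rintro i j j' ⟨x, y, rfl, rfl, h⟩ ⟨x', y', hx, rfl, h'⟩
    exact ((h1 x y h).2.1 x' y' h' hx).symm
  have R2 : ∀ i i' j, R i j → R i' j → i = i' := by
    rintro i i' j ⟨x, y, rfl, rfl, h⟩ ⟨x', y', rfl, hy, h'⟩
    obtain ⟨z, hz, hz'⟩ := (h1 x y h).2.2 y' hy
    rw [← α.inj hz' h', hz]
  let f : Fin k ≃. Fin k :=
    { toFun := fun i => if h : ∃ j, R i j then some h.choose else none
      invFun := fun j => if h : ∃ i, R i j then some h.choose else none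
      inv := by
        intro i j
        constructor
        · intro h
          split_ifs at h with h'
          have hs := h'.choose_spec
          rw [Option.some.injEq] at h
          rw [h] at hs
          have h'' : ∃ j, R i j := ⟨j, hs⟩
          rw [dif_pos h'', Option.some.injEq]
          exact R1 _ _ _ h''.choose_spec hs
        · intro h
          split_ifs at h with h'
          have hs := h'.choose_spec
          rw [Option.some.injEq] at h
          rw [h] at hs
          have h'' : ∃ i, R i j := ⟨i, hs⟩
          rw [dif_pos h'', Option.some.injEq]
          exact R2 _ _ _ h''.choose_spec hs }
  have hfR : ∀ i j, j ∈ f i ↔ R i j := by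
    intro i j
    change (if h : ∃ j, R i j then some h.choose else none) = some j ↔ _
    constructor
    · intro h
      split_ifs at h with h'
      have hs := h'.choose_spec
      rw [Option.some.injEq] at h
      rwa [h] at hs
    · intro hs
      have h'' : ∃ j, R i j := ⟨j, hs⟩
      rw [dif_pos h'', Option.some.injEq]
      exact R1 _ _ _ h''.choose_spec hs
  have hs : ∀ i, ∃ p : Equiv.Perm (Fin m), ∀ x y, blk k m x = i → y ∈ α x →
      y.modNat = p x.modNat := by
    intro i
    by_cases hi : ∃ j, R i j
    · obtain ⟨j, x, y, rfl, rfl, hxy⟩ := hi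
      have ht : ∀ r : Fin m, ∃ w, w ∈ α (mk (blk k m x) r) := fun r =>
        Option.isSome_iff_exists.mp ((h1 x y hxy).1 _ (blk_mk _ _))
      choose w hw using ht
      have hwb : ∀ r, blk k m (w r) = blk k m y := fun r =>
        (h1 x y hxy).2.1 _ _ (hw r) (blk_mk _ _)
      have hinj : Function.Injective (fun r => (w r).modNat) := by
        intro r r' hr
        have : w r = w r' := bext (by rw [hwb, hwb]) hr
        have h3 := α.inj (hw r) (this ▸ hw r')
        have h4 := congrArg Fin.modNat h3
        rwa [mod_mk, mod_mk] at h4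
      refine ⟨Equiv.ofBijective _ (Finite.injective_iff_bijective.mp hinj), ?_⟩
      intro x' y' hx' hy'
      rw [Equiv.ofBijective_apply]
      have := hw x'.modNat
      rw [← hx', mk_eta] at this
      rw [mem_uniq hy' this]
    · exact ⟨1, fun x y hx hy => (hi ⟨_, x, y, hx, rfl, hy⟩).elim⟩
  choose s hs using hs
  refine ⟨f, s, ?_, ?_⟩
  · intro i j i' j' hi hj hij
    rw [hfR] at hi hj
    obtain ⟨x, y, rfl, rfl, hxy⟩ := hi
    obtain ⟨x', y', rfl, rfl, hxy'⟩ := hj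
    exact h2 _ _ _ _ hxy hxy' hij
  · apply pext
    intro a b
    rw [mem_EE, hfR]
    constructor
    · intro h
      exact ⟨⟨a, b, rfl, rfl, h⟩, hs _ a b rfl h⟩
    · rintro ⟨⟨x, y, hx, hy, h⟩, hb⟩
      obtain ⟨w, hw⟩ := Option.isSome_iff_exists.mp ((h1 x y h).1 a hx.symm)
      have e1 := (h1 x y h).2.1 a w hw hx.symm
      have e2 := hs _ a w rfl hw
      have : b = w := bext (by rw [e1, hy]) (by rw [hb, e2])
      rw [this]; exact hw

lemma Xbar_eq (n m : ℕ) : XbarSet (n+1) m = Set.range (fun i => EH (n+1) m (xg n i)) := by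
  have hE : ∀ (f : Fin (n+1) ≃. Fin (n+1)) (a b : Fin ((n+1)*m)), b ∈ EH (n+1) m f a ↔
      blk (n+1) m b ∈ f (blk (n+1) m a) ∧ (b : ℕ) % m = (a : ℕ) % m := by
    intro f a b
    change b ∈ EE f 1 a ↔ _
    rw [mem_EE]
    simp only [Pi.one_apply, Equiv.Perm.one_apply, Fin.ext_iff, Fin.modNat]
  have h0 : ∀ a b, b ∈ EH (n+1) m (xg n 0) a ↔
      ((b : ℕ) % m = (a : ℕ) % m ∧ (b : ℕ) / m + 1 = (a : ℕ) / m) := by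
    intro a b
    rw [hE, xg_zero, mem_AA_zero, and_comm]
    rfl
  have h1 : ∀ (q : Fin n) a b, b ∈ EH (n+1) m (xg n q.succ) a ↔
      ((b : ℕ) % m = (a : ℕ) % m ∧ (a : ℕ) / m ≠ q + 1 ∧
        (((a : ℕ) / m = q ∧ (b : ℕ) / m = q + 1) ∨
         ((a : ℕ) / m ≠ q ∧ (b : ℕ) / m = (a : ℕ) / m))) := by
    intro q a b
    rw [hE, xg_succ, mem_AA_succ, and_comm]
    rfl
  ext f
  constructor
  · rintro (h | ⟨i, hi1, hi2, h⟩)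
    · exact ⟨0, pext fun a b => by rw [h0, h]⟩
    · refine ⟨Fin.succ ⟨n - i, by omega⟩, pext fun a b => ?_⟩
      rw [h1, h]
      have e1 : n + 1 - i = n - i + 1 := by omega
      rw [e1]
      rfl
  · rintro ⟨i, rfl⟩
    induction i using Fin.cases with
    | zero => left; exact h0
    | succ q =>
      right
      have := q.isLt
      refine ⟨n - q, by omega, by omega, fun a b => ?_⟩
      have e1 : n + 1 - (n - q) = (q : ℕ) + 1 := by omega
      have e2 : (q : ℕ) + 1 - 1 = q := by omega
      simp only [e1, e2]
      exact h1 q a b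

theorem stmt17 (k m : ℕ) (hk : 2 ≤ k) (hm : 2 ≤ m) :
    ∃ D : Set (Fin (k * m) ≃. Fin (k * m)),
      D ⊆ unitsSet k m ∧
      (Submonoid.closure (D ∪ XbarSet k m) : Set (Fin (k * m) ≃. Fin (k * m))) = POIkm k m ∧
      Set.ncard (D ∪ XbarSet k m) = 2 * k := by
  obtain ⟨n, rfl⟩ : ∃ n, k = n + 1 := ⟨k - 1, by omega⟩
  obtain ⟨x, y, t, hx1, hx, hy, hc⟩ := gen_pair m hm
  have hn : 1 ≤ n := by omega
  have hDu : Set.range (fun i => UH (n+1) m (dgen n x y i)) ⊆ unitsSet (n+1) m := by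
    rintro _ ⟨i, rfl⟩; exact UH_mem _
  refine ⟨Set.range (fun i => UH (n+1) m (dgen n x y i)), hDu, ?_, ?_⟩
  · rw [Xbar_eq]
    apply Set.Subset.antisymm
    · let S : Submonoid (Fin ((n+1) * m) ≃. Fin ((n+1) * m)) :=
        { carrier := POIkm (n+1) m
          one_mem' := POI_one _ _
          mul_mem' := POI_mul }
      change Submonoid.closure _ ≤ S
      rw [Submonoid.closure_le]
      rintro f (hf | ⟨i, rfl⟩)
      · exact (hDu hf).1
      · exact EE_mem _ _ (AA_OP _ _)
    · intro α hα
      obtain ⟨f, s, hf, rfl⟩ := POI_decomp (by omega) α hα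
      rw [EE_factor]
      apply mul_mem
      · apply Submonoid.closure_mono Set.subset_union_left
        have h := MonoidHom.map_mclosure (UH (n+1) m) (Set.range (dgen n x y))
        rw [dgen_closure n hn x y t hx hy hc, ← Set.range_comp] at h
        change _ ∈ Submonoid.closure (Set.range (⇑(UH (n+1) m) ∘ dgen n x y))
        rw [← h]
        exact ⟨_, trivial, rfl⟩
      · apply Submonoid.closure_mono Set.subset_union_right
        have h := MonoidHom.map_mclosure (EH (n+1) m) (Set.range (xg n))
        rw [← Set.range_comp] at h
        change _ ∈ Submonoid.closure (Set.range (⇑(EH (n+1) m) ∘ xg n))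
        rw [← h]
        exact ⟨f, OP_closure_xg n f hf, rfl⟩
  · have hd : Function.Injective (fun i => UH (n+1) m (dgen n x y i)) :=
      (UH_inj _ _).comp (dgen_inj n hn x y t hx1 hx hy)
    have he : Function.Injective (fun i => EH (n+1) m (xg n i)) :=
      (EH_inj _ _ (by omega)).comp (xg_inj n)
    rw [Xbar_eq, Set.ncard_union_eq]
    · rw [← Set.image_univ, Set.ncard_image_of_injective _ hd, ← Set.image_univ,
        Set.ncard_image_of_injective _ he, Set.ncard_univ]
      simp
      ring
    · rw [Set.disjoint_left]
      rintro f hf ⟨i, rfl⟩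
      obtain ⟨b, hb⟩ := Option.isSome_iff_exists.mp ((hDu hf).2.1 (mk i ⟨0, by omega⟩))
      have h := ((mem_EE _ _ _ _).mp hb).1
      rw [blk_mk, xg, (AA_none _ _ _).mpr rfl] at h
      cases h

end POIPaper
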